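/- Let I be a monomial ideal in k[x,y], P = {g_1, …, g_{k+1}} with P(I) ⊆ P ⊆ P*(I), ordered in descending y-degree. Set d_P = min{dist_x(I), dist_y(I)} − 2 if |P| > 2 and d_P = 0 if |P| = 2, and let D ≥ (μ(I) − |P|)·δ_P + |P|·d_P. Then for all ℓ ≥ 0, I^{D+ℓ} = Σ_{i=1}^{k} (g_i, g_{i+1})^ℓ · I^D. -/

import Mathlib

/-- Membership of a monomial in the ideal generated by `G`. -/
def memI (G : Finset (ℕ × ℕ)) (m : ℕ × ℕ) : Prop := ∃ g ∈ G, g ≤ m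

/-- Membership of a monomial in the `n`-th power of the ideal generated by `G`. -/
def memNpow (G : Finset (ℕ × ℕ)) (n : ℕ) (m : ℕ × ℕ) : Prop :=
  ∃ s : Multiset (ℕ × ℕ), (∀ x ∈ s, x ∈ G) ∧ Multiset.card s = n ∧ s.sum ≤ m

/-- `f` lies in the integral closure of `(g, h)`. -/
def inIC (g h f : ℕ × ℕ) : Prop :=
  ∃ n : ℕ, 0 < n ∧ ∃ k : ℕ, k ≤ n ∧ k • g + (n - k) • h ≤ n • f

/-- `f` is a persistent generator of the ideal with minimal generating set `G`. -/
def persistent (G : Finset (ℕ × ℕ)) (f : ℕ × ℕ) : Prop :=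
  f ∈ G ∧ ∀ g h : ℕ × ℕ, memI G g → memI G h → g ≠ f → h ≠ f → ¬ inIC g h f

/-- `f` is a weakly persistent generator. -/
def weaklyPersistent (G : Finset (ℕ × ℕ)) (f : ℕ × ℕ) : Prop :=
  f ∈ G ∧ ∀ n : ℕ, 0 < n →
    memNpow G n (n • f) ∧ ∀ m, memNpow G n m → m ≤ n • f → m = n • f

/-- x-distance of two monomials. -/
def dX (p q : ℕ × ℕ) : ℕ := max p.1 q.1 - min p.1 q.1

/-- y-distance of two monomials. -/
def dY (p q : ℕ × ℕ) : ℕ := max p.2 q.2 - min p.2 q.2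

/-- If `b` lies on or above the segment from `a` to `c`, some power of `b` is divisible by a
product of powers of `a` and `c`. -/
theorem exists_nsmul_add_nsmul_le {a b c : ℕ × ℕ} (hab : a.1 < b.1) (hbc : b.1 < c.1)
    (hcb : c.2 < b.2) (hba : b.2 < a.2)
    (h : (c.1 - b.1) * (a.2 - b.2) ≤ (b.1 - a.1) * (b.2 - c.2)) :
    ∃ p q : ℕ, 0 < p ∧ 0 < q ∧ p + q = min (c.1 - a.1) (a.2 - c.2) ∧
      p • a + q • c ≤ (p + q) • b := by
  obtain ⟨a1, a2⟩ := a
  obtain ⟨b1, b2⟩ := b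
  obtain ⟨c1, c2⟩ := c
  dsimp only at *
  obtain ⟨u, rfl⟩ := Nat.exists_eq_add_of_le hab.le
  obtain ⟨v, rfl⟩ := Nat.exists_eq_add_of_le hbc.le
  obtain ⟨v', rfl⟩ := Nat.exists_eq_add_of_le hcb.le
  obtain ⟨u', rfl⟩ := Nat.exists_eq_add_of_le hba.le
  simp only [Nat.add_sub_cancel_left] at h
  rcases le_total (u + v) (u' + v') with hle | hle
  · refine ⟨v, u, by omega, by omega, by omega, ?_⟩
    simp only [Prod.smul_mk, Prod.mk_add_mk, Prod.mk_le_mk, smul_eq_mul]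
    constructor <;> nlinarith
  · refine ⟨v', u', by omega, by omega, by omega, ?_⟩
    simp only [Prod.smul_mk, Prod.mk_add_mk, Prod.mk_le_mk, smul_eq_mul]
    constructor <;> nlinarith

/-- If `b` lies on or below the segment from `a` to `c`, some power of `b` divides a
product of powers of `a` and `c`. -/
theorem exists_nsmul_le_nsmul_add {a b c : ℕ × ℕ} (hab : a.1 < b.1) (hbc : b.1 < c.1)
    (hcb : c.2 < b.2) (hba : b.2 < a.2)
    (h : (b.1 - a.1) * (b.2 - c.2) ≤ (c.1 - b.1) * (a.2 - b.2)) :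
    ∃ p q : ℕ, 0 < p ∧ 0 < q ∧ p + q = min (c.1 - a.1) (a.2 - c.2) ∧
      (p + q) • b ≤ p • a + q • c := by
  obtain ⟨a1, a2⟩ := a
  obtain ⟨b1, b2⟩ := b
  obtain ⟨c1, c2⟩ := c
  dsimp only at *
  obtain ⟨u, rfl⟩ := Nat.exists_eq_add_of_le hab.le
  obtain ⟨v, rfl⟩ := Nat.exists_eq_add_of_le hbc.le
  obtain ⟨v', rfl⟩ := Nat.exists_eq_add_of_le hcb.le
  obtain ⟨u', rfl⟩ := Nat.exists_eq_add_of_le hba.le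
  simp only [Nat.add_sub_cancel_left] at h
  rcases le_total (u + v) (u' + v') with hle | hle
  · refine ⟨v, u, by omega, by omega, by omega, ?_⟩
    simp only [Prod.smul_mk, Prod.mk_add_mk, Prod.mk_le_mk, smul_eq_mul]
    constructor <;> nlinarith
  · refine ⟨v', u', by omega, by omega, by omega, ?_⟩
    simp only [Prod.smul_mk, Prod.mk_add_mk, Prod.mk_le_mk, smul_eq_mul]
    constructor <;> nlinarith

/-- A product of powers of two generators lies in the corresponding power of the ideal. -/
theorem memNpow_nsmul_add_nsmul {G : Finset (ℕ × ℕ)} {a c : ℕ × ℕ} (ha : a ∈ G) (hc : c ∈ G)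
    (p q : ℕ) : memNpow G (p + q) (p • a + q • c) := by
  refine ⟨Multiset.replicate p a + Multiset.replicate q c, fun x hx => ?_, by simp, by simp⟩
  rcases Multiset.mem_add.1 hx with hx | hx <;> rw [Multiset.eq_of_mem_replicate hx] <;>
    assumption

/-- A weakly persistent generator lies on or below the segment between any two generators. -/
theorem weaklyPersistent.below {G : Finset (ℕ × ℕ)} {a b c : ℕ × ℕ}
    (hb : weaklyPersistent G b) (ha : a ∈ G) (hc : c ∈ G) (hab : a.1 < b.1) (hbc : b.1 < c.1)
    (hcb : c.2 < b.2) (hba : b.2 < a.2) :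
    (b.1 - a.1) * (b.2 - c.2) ≤ (c.1 - b.1) * (a.2 - b.2) := by
  by_contra! hlt
  obtain ⟨p, q, hp, hq, -, hle⟩ := exists_nsmul_add_nsmul_le hab hbc hcb hba hlt.le
  have heq := (hb.2 (p + q) (by omega)).2 _ (memNpow_nsmul_add_nsmul ha hc p q) hle
  obtain ⟨a1, a2⟩ := a
  obtain ⟨b1, b2⟩ := b
  obtain ⟨c1, c2⟩ := c
  dsimp only at *
  obtain ⟨u, rfl⟩ := Nat.exists_eq_add_of_le hab.le
  obtain ⟨v, rfl⟩ := Nat.exists_eq_add_of_le hbc.le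
  obtain ⟨v', rfl⟩ := Nat.exists_eq_add_of_le hcb.le
  obtain ⟨u', rfl⟩ := Nat.exists_eq_add_of_le hba.le
  simp only [Nat.add_sub_cancel_left] at hlt
  simp only [Prod.smul_mk, Prod.mk_add_mk, Prod.mk.injEq, smul_eq_mul] at heq
  have h1 : p * u = q * v := by nlinarith [heq.1]
  have h2 : p * u' = q * v' := by nlinarith [heq.2]
  have h3 : p * (u * v') = p * (v * u') := by
    rw [← mul_assoc, h1, mul_left_comm, h2]
    ring
  exact hlt.ne' (Nat.eq_of_mul_eq_mul_left hp h3)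

/-- Every nonnegative linear functional with positive `y`-weight is minimised on `G` at some persistent generator. -/
theorem exists_persistent_min {G : Finset (ℕ × ℕ)} (hne : G.Nonempty) {W V : ℕ} (hV : 0 < V) :
    ∃ f, persistent G f ∧ ∀ x ∈ G, W * f.1 + V * f.2 ≤ W * x.1 + V * x.2 := by
  obtain ⟨f, hf, hfmin⟩ :=
    G.exists_min_image (fun x => toLex (W * x.1 + V * x.2, x.1)) hne
  have hlex : ∀ x ∈ G, W * f.1 + V * f.2 < W * x.1 + V * x.2 ∨
      W * f.1 + V * f.2 = W * x.1 + V * x.2 ∧ f.1 ≤ x.1 := fun x hx => by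
    simpa [Prod.Lex.toLex_le_toLex] using hfmin x hx
  have hmem : ∀ x, memI G x → W * f.1 + V * f.2 < W * x.1 + V * x.2 ∨
      W * f.1 + V * f.2 = W * x.1 + V * x.2 ∧ f.1 ≤ x.1 := by
    rintro x ⟨y, hy, hyx⟩
    have h1 := Nat.mul_le_mul_left W hyx.1
    have h2 := Nat.mul_le_mul_left V hyx.2
    have h3 := hyx.1
    rcases hlex y hy with h | ⟨h, h'⟩ <;> omega
  refine ⟨f, ⟨hf, ?_⟩, fun x hx => by rcases hlex x hx with h | h <;> omega⟩
  rintro g h hg hh hgf hhf ⟨n, hn, k, hk, hle⟩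
  obtain ⟨r, rfl⟩ := Nat.exists_eq_add_of_le hk
  have hle1 : k * g.1 + r * h.1 ≤ (k + r) * f.1 := by simpa using hle.1
  have hle2 : k * g.2 + r * h.2 ≤ (k + r) * f.2 := by simpa using hle.2
  have key : ∀ x, memI G x → x ≠ f → W * f.1 + V * f.2 < W * x.1 + V * x.2 ∨
      W * f.1 + V * f.2 = W * x.1 + V * x.2 ∧ f.1 < x.1 := by
    intro x hx hxf
    rcases hmem x hx with h | ⟨h, h'⟩
    · exact Or.inl h
    · refine Or.inr ⟨h, lt_of_le_of_ne h' fun he => hxf ?_⟩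
      rw [he] at h
      exact Prod.ext he.symm (Nat.eq_of_mul_eq_mul_left hV (by omega)).symm
  have hL : k * (W * g.1 + V * g.2) + r * (W * h.1 + V * h.2) ≤
      k * (W * f.1 + V * f.2) + r * (W * f.1 + V * f.2) := by nlinarith
  have hwt : ∀ (j : ℕ) (x : ℕ × ℕ), memI G x → x ≠ f →
      j * (W * f.1 + V * f.2) ≤ j * (W * x.1 + V * x.2) ∧
      (0 < j → j * (W * f.1 + V * f.2) = j * (W * x.1 + V * x.2) → j * f.1 < j * x.1) := by
    intro j x hx hxf
    have := key x hx hxf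
    refine ⟨Nat.mul_le_mul_left _ (by omega), fun hj he => Nat.mul_lt_mul_of_pos_left ?_ hj⟩
    have := Nat.eq_of_mul_eq_mul_left hj he
    omega
  obtain ⟨hg1, hg2⟩ := hwt k g hg hgf
  obtain ⟨hh1, hh2⟩ := hwt r h hh hhf
  rw [add_mul] at hle1
  rcases Nat.eq_zero_or_pos k with rfl | hk0
  · have := hh2 (by omega) (by omega)
    omega
  · have h1 := hg2 hk0 (by omega)
    rcases Nat.eq_zero_or_pos r with rfl | hr0
    · omega
    · have h2 := hh2 hr0 (by omega)
      omega

/-- Two distinct elements of an antichain are ordered oppositely by their coordinates. -/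
theorem fst_lt_fst_of_snd_lt_snd {G : Finset (ℕ × ℕ)}
    (hmin : ∀ p ∈ G, ∀ q ∈ G, p ≤ q → p = q) {p q : ℕ × ℕ} (hp : p ∈ G) (hq : q ∈ G)
    (h : q.2 < p.2) : p.1 < q.1 := by
  by_contra! h'
  have := hmin q hq p hp ⟨h', h.le⟩
  simp [this] at h

section Chain

variable {G : Finset (ℕ × ℕ)} {k : ℕ} {g : Fin (k + 1) → ℕ × ℕ}

/-- All generators lie on or above the lines through consecutive members of the chain. -/
theorem chain_above (hne : G.Nonempty) (hx : StrictMono fun i => (g i).1)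
    (hy : StrictAnti fun i => (g i).2) (hPG : ∀ i, g i ∈ G)
    (hWP : ∀ i, weaklyPersistent G (g i)) (hPI : ∀ f, persistent G f → ∃ i, g i = f)
    (i : Fin k) {f : ℕ × ℕ} (hf : f ∈ G) :
    ((g i.castSucc).2 - (g i.succ).2) * (g i.castSucc).1 +
        ((g i.succ).1 - (g i.castSucc).1) * (g i.castSucc).2 ≤
      ((g i.castSucc).2 - (g i.succ).2) * f.1 +
        ((g i.succ).1 - (g i.castSucc).1) * f.2 := by
  have hx' := hx i.castSucc_lt_succ
  have hy' := hy i.castSucc_lt_succ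
  dsimp only at hx' hy'
  set W := (g i.castSucc).2 - (g i.succ).2 with hWdef
  set V := (g i.succ).1 - (g i.castSucc).1 with hVdef
  have hV : 0 < V := by omega
  obtain ⟨f₀, hf₀, hf₀min⟩ := exists_persistent_min hne (W := W) hV
  obtain ⟨j, rfl⟩ := hPI f₀ hf₀
  refine le_trans ?_ (hf₀min f hf)
  have hac : W * (g i.castSucc).1 + V * (g i.castSucc).2 =
      W * (g i.succ).1 + V * (g i.succ).2 := by
    have e1 : (g i.succ).1 = (g i.castSucc).1 + V := by omega
    have e2 : (g i.castSucc).2 = (g i.succ).2 + W := by omega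
    rw [e1, e2]
    ring
  have aux : ∀ {a b c : Fin (k + 1)}, a < b → b < c → ∃ p q : ℕ, 0 < p ∧ 0 < q ∧
      (p + q) * (W * (g b).1 + V * (g b).2) ≤
        p * (W * (g a).1 + V * (g a).2) + q * (W * (g c).1 + V * (g c).2) := by
    intro a b c hab hbc
    obtain ⟨p, q, hp, hq, -, hle⟩ := exists_nsmul_le_nsmul_add (hx hab) (hx hbc) (hy hbc) (hy hab)
      ((hWP b).below (hPG a) (hPG c) (hx hab) (hx hbc) (hy hbc) (hy hab))
    have h1 : (p + q) * (g b).1 ≤ p * (g a).1 + q * (g c).1 := by simpa using hle.1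
    have h2 : (p + q) * (g b).2 ≤ p * (g a).2 + q * (g c).2 := by simpa using hle.2
    refine ⟨p, q, hp, hq, ?_⟩
    have h3 := Nat.mul_le_mul_left W h1
    have h4 := Nat.mul_le_mul_left V h2
    linarith
  by_contra! hlt
  rcases lt_trichotomy j i.castSucc with hj | rfl | hj
  · obtain ⟨p, q, hp, hq, h⟩ := aux hj i.castSucc_lt_succ
    have := Nat.mul_lt_mul_of_pos_left hlt hp
    rw [← hac] at h
    linarith
  · exact lt_irrefl _ hlt
  · rcases (Fin.castSucc_lt_iff_succ_le.1 hj).eq_or_lt with rfl | hj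
    · omega
    · obtain ⟨p, q, hp, hq, h⟩ := aux i.castSucc_lt_succ hj
      have := Nat.mul_lt_mul_of_pos_left hlt hq
      rw [← hac] at h
      linarith

/-- The first member of the chain has the least `x`-degree. -/
theorem chain_first_le (hne : G.Nonempty) (hx : StrictMono fun i => (g i).1)
    (hPI : ∀ f, persistent G f → ∃ i, g i = f) {f : ℕ × ℕ} (hf : f ∈ G) : (g 0).1 ≤ f.1 := by
  obtain ⟨f₀, hf₀, hmin⟩ :=
    exists_persistent_min hne (W := G.sup (fun x => x.2) + 1) (V := 1) one_pos
  obtain ⟨j, rfl⟩ := hPI f₀ hf₀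
  have h1 := hmin f hf
  have h2 : f.2 ≤ G.sup (fun x => x.2) := Finset.le_sup (f := fun x : ℕ × ℕ => x.2) hf
  have h3 : (g 0).1 ≤ (g j).1 := hx.monotone (Fin.zero_le j)
  by_contra! h4
  nlinarith

/-- The last member of the chain has the least `y`-degree. -/
theorem chain_last_le (hne : G.Nonempty) (hy : StrictAnti fun i => (g i).2)
    (hPI : ∀ f, persistent G f → ∃ i, g i = f) {f : ℕ × ℕ} (hf : f ∈ G) :
    (g (Fin.last k)).2 ≤ f.2 := by
  obtain ⟨f₀, hf₀, hmin⟩ :=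
    exists_persistent_min hne (W := 1) (V := G.sup (fun x => x.1) + 1) (by omega)
  obtain ⟨j, rfl⟩ := hPI f₀ hf₀
  have h1 := hmin f hf
  have h2 : f.1 ≤ G.sup (fun x => x.1) := Finset.le_sup (f := fun x : ℕ × ℕ => x.1) hf
  have h3 : (g (Fin.last k)).2 ≤ (g j).2 := hy.antitone (Fin.le_last j)
  by_contra! h4
  nlinarith

/-- A generator outside the chain lies strictly between two consecutive members. -/
theorem chain_exists_between (hne : G.Nonempty) (hmin : ∀ p ∈ G, ∀ q ∈ G, p ≤ q → p = q)
    (hx : StrictMono fun i => (g i).1) (hy : StrictAnti fun i => (g i).2) (hPG : ∀ i, g i ∈ G)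
    (hPI : ∀ f, persistent G f → ∃ i, g i = f) {f : ℕ × ℕ} (hf : f ∈ G) (hfg : ∀ i, g i ≠ f) :
    ∃ i : Fin k, (g i.castSucc).1 < f.1 ∧ f.1 < (g i.succ).1 ∧
      (g i.succ).2 < f.2 ∧ f.2 < (g i.castSucc).2 := by
  have hsnd : ∀ j, (g j).1 < f.1 → f.2 < (g j).2 := fun j h => by
    by_contra! h'
    exact hfg j (hmin _ (hPG j) _ hf ⟨h.le, h'⟩)
  have hsnd' : ∀ j, f.1 < (g j).1 → (g j).2 < f.2 := fun j h => by
    by_contra! h'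
    exact hfg j (hmin _ hf _ (hPG j) ⟨h.le, h'⟩).symm
  have hne1 : ∀ j, (g j).1 ≠ f.1 := fun j h => by
    rcases le_total (g j).2 f.2 with h' | h'
    · exact hfg j (hmin _ (hPG j) _ hf ⟨h.le, h'⟩)
    · exact hfg j (hmin _ hf _ (hPG j) ⟨h.ge, h'⟩).symm
  by_contra! hcon
  have hall : ∀ j : Fin (k + 1), (g j).1 < f.1 := by
    intro j
    induction j using Fin.induction with
    | zero => exact lt_of_le_of_ne (chain_first_le hne hx hPI hf) (hne1 0)
    | succ i ih =>
      by_contra! h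
      have h' := lt_of_le_of_ne h (hne1 i.succ).symm
      exact absurd (hsnd _ ih) (hcon i ih h' (hsnd' _ h')).not_gt
  exact hfg _ (hmin _ (hPG (Fin.last k)) _ hf ⟨(hall _).le, chain_last_le hne hy hPI hf⟩)

end Chain

/-- Strict convexity of the square, as used for exchanging generators. -/
theorem add_mul_sq_lt {p q a b c : ℕ} (hp : 0 < p) (hq : 0 < q) (hac : a < c)
    (h : (p + q) * b ≤ p * a + q * c) :
    (p + q) * b ^ 2 < p * a ^ 2 + q * c ^ 2 := by
  have h1 : ((p + q) * b) ^ 2 ≤ (p * a + q * c) ^ 2 := Nat.pow_le_pow_left h 2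
  have h2 : (p * a + q * c) ^ 2 < (p + q) * (p * a ^ 2 + q * c ^ 2) := by
    obtain ⟨e, rfl⟩ := Nat.exists_eq_add_of_le hac.le
    have : 0 < p * q * e ^ 2 := by
      have : 0 < e := by omega
      positivity
    nlinarith
  refine lt_of_mul_lt_mul_left (a := p + q) ?_ (Nat.zero_le _)
  nlinarith

/-- A lexicographically minimal factorisation with respect to two natural weights. -/
theorem exists_lex_min {α : Type*} (S : α → Prop) (hS : ∃ s, S s) (φ ψ : α → ℕ) :
    ∃ s, S s ∧ ∀ t, S t → φ s ≤ φ t ∧ (φ t = φ s → ψ s ≤ ψ t) := by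
  obtain ⟨s, hs, hmin⟩ := (InvImage.wf (fun s => toLex (φ s, ψ s))
    (wellFounded_lt (α := ℕ ×ₗ ℕ))).has_min {s | S s} hS
  refine ⟨s, hs, fun t ht => ?_⟩
  have := hmin t ht
  simp only [InvImage, Prod.Lex.toLex_lt_toLex] at this
  omega

/-- Theorem I^{D+ℓ}: Let `G` be the minimal generating set of `I`,
`g : Fin (k+1) → ℕ×ℕ` enumerate `P` with `P(I) ⊆ P ⊆ P*(I)` in descending
y-degree, `δ_P = max_i min(dist_x(g_i,g_{i+1}), dist_y(g_i,g_{i+1})) − 1`,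
`d_P = min(dist_x I, dist_y I) − 2` if `|P| > 2` and `0` if `|P| = 2`, and let
`D ≥ (μ(I) − |P|)·δ_P + |P|·d_P`.  Then for all `ℓ ≥ 0`,
`I^{D+ℓ} = Σ_{i=1}^{k} (g_i, g_{i+1})^ℓ · I^D` (as sets of monomials). -/
theorem power_decomposition (G : Finset (ℕ × ℕ)) (hne : G.Nonempty)
    (hmin : ∀ p ∈ G, ∀ q ∈ G, p ≤ q → p = q)
    (k : ℕ) (hk : 0 < k) (g : Fin (k + 1) → ℕ × ℕ)
    (hy : StrictAnti fun i => (g i).2)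
    (hPG : ∀ i, g i ∈ G)
    (hWP : ∀ i, weaklyPersistent G (g i))
    (hPI : ∀ f, persistent G f → ∃ i, g i = f)
    (δp d D : ℕ)
    (hδp : δp = (Finset.univ.sup fun i : Fin k =>
      min (dX (g i.castSucc) (g i.succ)) (dY (g i.castSucc) (g i.succ))) - 1)
    (hd : d = if 1 < k then
        min (G.sup (fun f => f.1) - G.inf' hne (fun f => f.1))
            (G.sup (fun f => f.2) - G.inf' hne (fun f => f.2)) - 2
      else 0)
    (hD : (G.card - (k + 1)) * δp + (k + 1) * d ≤ D) :
    ∀ ℓ : ℕ, ∀ m : ℕ × ℕ,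
      memNpow G (D + ℓ) m ↔
        ∃ i : Fin k, ∃ s : Multiset (ℕ × ℕ),
          (∀ x ∈ s, x = g i.castSucc ∨ x = g i.succ) ∧ Multiset.card s = ℓ ∧
          ∃ m' : ℕ × ℕ, memNpow G D m' ∧ s.sum + m' ≤ m := by
  classical
  have hx : StrictMono fun i => (g i).1 := fun i j hij =>
    fst_lt_fst_of_snd_lt_snd hmin (hPG i) (hPG j) (hy hij)
  intro ℓ m
  constructor
  swap
  · rintro ⟨i, s, hs, hcard, m', ⟨t, ht, htcard, htsum⟩, hle⟩
    refine ⟨t + s, fun x hxm => ?_, by simp [hcard, htcard], ?_⟩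
    · rcases Multiset.mem_add.1 hxm with h | h
      · exact ht x h
      · rcases hs x h with rfl | rfl <;> exact hPG _
    · rw [Multiset.sum_add, add_comm]
      exact (add_le_add_right htsum _).trans hle
  intro hmem
  set P : Finset (ℕ × ℕ) := Finset.univ.image g with hP
  have hginj : Function.Injective g := fun i j h => hx.injective (by simp [h])
  have hPsub : P ⊆ G := by
    intro x hxP
    obtain ⟨i, -, rfl⟩ := Finset.mem_image.1 hxP
    exact hPG i
  have hPcard : P.card = k + 1 := by
    rw [hP, Finset.card_image_of_injective _ hginj, Finset.card_univ, Fintype.card_fin]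
  have hgP : ∀ i, g i ∈ P := fun i => Finset.mem_image_of_mem g (Finset.mem_univ i)
  obtain ⟨s, ⟨hsG, hscard, hssum⟩, hsmin⟩ := exists_lex_min
    (fun s : Multiset (ℕ × ℕ) => (∀ x ∈ s, x ∈ G) ∧ Multiset.card s = D + ℓ ∧ s.sum ≤ m) hmem
    (fun s => s.countP (· ∉ P)) (fun s => (s.map fun x => x.1 ^ 2).sum)
  have hδ : ∀ f ∈ G, f ∉ P → s.count f ≤ δp := by
    intro f hf hfP
    by_contra! hcount
    obtain ⟨i, h1, h2, h3, h4⟩ := chain_exists_between hne hmin hx hy hPG hPI hf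
      (fun i h => hfP (h ▸ hgP i))
    have habove := chain_above hne hx hy hPG hWP hPI i hf
    obtain ⟨p, q, hp, hq, hpq, hle⟩ := exists_nsmul_add_nsmul_le h1 h2 h3 h4 (by
      zify [h1.le, h2.le, h3.le, h4.le, (h1.trans h2).le, (h3.trans h4).le] at habove ⊢
      linarith)
    have hpδ : p + q ≤ δp + 1 := by
      have hsup := Finset.le_sup (f := fun i : Fin k =>
        min (dX (g i.castSucc) (g i.succ)) (dY (g i.castSucc) (g i.succ))) (Finset.mem_univ i)
      simp only [dX, dY] at hsup
      simp only [dX, dY] at hδp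
      omega
    obtain ⟨r, rfl⟩ := Multiset.le_iff_exists_add.1
      (Multiset.le_count_iff_replicate_le.1 (show p + q ≤ s.count f by omega))
    have hnew := (hsmin (Multiset.replicate p (g i.castSucc) +
      Multiset.replicate q (g i.succ) + r) ⟨fun x hxm => ?_, ?_, ?_⟩).1
    · have e : ∀ (n : ℕ) (x : ℕ × ℕ), (Multiset.replicate n x).countP (· ∉ P) =
          if x ∉ P then n else 0 := fun n x => by
        induction n with
        | zero => simp
        | succ n ih => rw [Multiset.replicate_succ, Multiset.countP_cons, ih]; split_ifs <;> rfl
      simp only [Multiset.countP_add, e, hgP, hfP, not_true_eq_false, not_false_eq_true,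
        if_true, if_false] at hnew
      omega
    · rcases Multiset.mem_add.1 hxm with h | h
      · rcases Multiset.mem_add.1 h with h | h <;> rw [Multiset.eq_of_mem_replicate h] <;>
          exact hPG _
      · exact hsG x (Multiset.mem_add.2 (Or.inr h))
    · simpa using hscard
    · refine le_trans ?_ hssum
      simp only [Multiset.sum_add, Multiset.sum_replicate]
      exact add_le_add_left hle _
  have hdcount : ∀ a b c : Fin (k + 1), a < b → b < c → s.count (g a) ≤ d ∨ s.count (g c) ≤ d := by
    intro a b c hab hbc
    by_contra! hcount
    obtain ⟨hca, hcc⟩ := hcount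
    obtain ⟨p, q, hp, hq, hpq, hle⟩ := exists_nsmul_le_nsmul_add (hx hab) (hx hbc) (hy hbc)
      (hy hab) ((hWP b).below (hPG a) (hPG c) (hx hab) (hx hbc) (hy hbc) (hy hab))
    have hpd : p + q ≤ d + 2 := by
      have h1k : 1 < k := by omega
      rw [if_pos h1k] at hd
      have e1 : (g c).1 ≤ G.sup (fun f => f.1) :=
        Finset.le_sup (f := fun f : ℕ × ℕ => f.1) (hPG c)
      have e2 : (g a).2 ≤ G.sup (fun f => f.2) :=
        Finset.le_sup (f := fun f : ℕ × ℕ => f.2) (hPG a)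
      have e3 : G.inf' hne (fun f => f.1) ≤ (g a).1 :=
        Finset.inf'_le (fun f : ℕ × ℕ => f.1) (hPG a)
      have e4 : G.inf' hne (fun f => f.2) ≤ (g c).2 :=
        Finset.inf'_le (fun f : ℕ × ℕ => f.2) (hPG c)
      omega
    have hac : g a ≠ g c := hginj.ne (hab.trans hbc).ne
    obtain ⟨r, rfl⟩ := Multiset.le_iff_exists_add.1
      (show Multiset.replicate p (g a) + Multiset.replicate q (g c) ≤ s by
        rw [Multiset.le_iff_count]
        intro x
        rw [Multiset.count_add, Multiset.count_replicate, Multiset.count_replicate]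
        split_ifs with h1 h2 h2
        · exact absurd (h1.trans h2.symm) hac
        · subst h1; omega
        · subst h2; omega
        · omega)
    have hnew := (hsmin (Multiset.replicate (p + q) (g b) + r) ⟨fun x hxm => ?_, ?_, ?_⟩).2 ?_
    · have hsq := add_mul_sq_lt hp hq (hx (hab.trans hbc))
        (b := (g b).1) (by simpa using hle.1)
      dsimp only at hsq
      simp only [Multiset.map_add, Multiset.sum_add, Multiset.map_replicate,
        Multiset.sum_replicate, smul_eq_mul] at hnew
      omega
    · rcases Multiset.mem_add.1 hxm with h | h
      · rw [Multiset.eq_of_mem_replicate h]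
        exact hPG _
      · exact hsG x (Multiset.mem_add.2 (Or.inr h))
    · simpa using hscard
    · refine le_trans ?_ hssum
      simp only [Multiset.sum_add, Multiset.sum_replicate]
      exact add_le_add_left hle _
    · have e : ∀ (n : ℕ) (i : Fin (k + 1)),
          (Multiset.replicate n (g i)).countP (· ∉ P) = 0 := fun n i =>
        Multiset.countP_eq_zero.2 fun x hxm => by
          rw [Multiset.eq_of_mem_replicate hxm]
          exact not_not.2 (hgP i)
      simp only [Multiset.countP_add, e]
  obtain ⟨i, hi⟩ : ∃ i : Fin k, ∀ j, j ≠ i.castSucc → j ≠ i.succ → s.count (g j) ≤ d := by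
    by_cases hbig : ∃ i : Fin k, d < s.count (g i.castSucc)
    · obtain ⟨i, hi, hfirst⟩ := (wellFounded_lt (α := Fin k)).has_min
        {i | d < s.count (g i.castSucc)} hbig
      refine ⟨i, fun j hj hj' => ?_⟩
      rcases lt_or_gt_of_ne hj with hlt | hgt
      · by_contra! h
        exact hfirst (j.castLT (by omega)) (by simpa using h) hlt
      · rcases hdcount _ _ j i.castSucc_lt_succ
          (lt_of_le_of_ne (Fin.castSucc_lt_iff_succ_le.1 hgt) hj'.symm) with h | h
        · exact absurd hi h.not_gt
        · exact h
    · push Not at hbig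
      refine ⟨⟨k - 1, by omega⟩, fun j _ hj => ?_⟩
      rcases Fin.eq_castSucc_or_eq_last j with ⟨i, rfl⟩ | rfl
      · exact hbig i
      · exact absurd (by ext; simp; omega) hj
  set F : ℕ × ℕ → Prop := fun x => x = g i.castSucc ∨ x = g i.succ with hF
  have hsplit := Multiset.filter_add_not F s
  have hrest : Multiset.card (s.filter (¬ F ·)) ≤ D := by
    refine le_trans ?_ hD
    rw [← Multiset.sum_count_eq_card (s := G) fun x hxm => hsG x (Multiset.mem_of_mem_filter hxm),
      ← Finset.sum_sdiff hPsub]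
    refine add_le_add ?_ ?_
    · rw [← hPcard, ← Finset.card_sdiff_of_subset hPsub, ← smul_eq_mul]
      refine Finset.sum_le_card_nsmul _ _ _ fun x hxm => ?_
      rw [Finset.mem_sdiff] at hxm
      exact (Multiset.count_le_of_le x (Multiset.filter_le _ s)).trans (hδ x hxm.1 hxm.2)
    · rw [← hPcard, ← smul_eq_mul]
      refine Finset.sum_le_card_nsmul _ _ _ fun x hxm => ?_
      obtain ⟨j, -, rfl⟩ := Finset.mem_image.1 hxm
      by_cases hFj : F (g j)
      · rw [Multiset.count_filter_of_neg (p := (¬ F ·)) (not_not.2 hFj)]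
        exact Nat.zero_le d
      · refine (Multiset.count_le_of_le _ (Multiset.filter_le _ s)).trans (hi j ?_ ?_)
        · rintro rfl
          exact hFj (Or.inl rfl)
        · rintro rfl
          exact hFj (Or.inr rfl)
  have hcardsplit := congrArg Multiset.card hsplit
  rw [Multiset.card_add, hscard] at hcardsplit
  obtain ⟨t, ht⟩ := Multiset.card_pos_iff_exists_mem.1
    ((Nat.choose_pos (show ℓ ≤ Multiset.card (s.filter F) by omega)).trans_eq
      (Multiset.card_powersetCard ℓ (s.filter F)).symm)
  obtain ⟨htle, htcard⟩ := Multiset.mem_powersetCard.1 ht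
  have hts := htle.trans (Multiset.filter_le F s)
  obtain ⟨r, rfl⟩ := Multiset.le_iff_exists_add.1 hts
  rw [Multiset.card_add] at hscard
  refine ⟨i, t, fun x hxm => (Multiset.mem_filter.1 (Multiset.mem_of_le htle hxm)).2, htcard,
    r.sum, ⟨r, fun x hxm => hsG x (Multiset.mem_add.2 (Or.inr hxm)), by omega, le_rfl⟩, ?_⟩
  rwa [← Multiset.sum_add]
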